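/- arXiv:2202.06677 — 3 statements merged into one kernel-verified Lean document; each statement's English description precedes it below -/
import Mathlib

section
/- Let Σ = (X, X₀, X_S, U, →, Y, H) be a finite metric system, let δ ≥ 0, and let Obs(Σ) = (Q, Q₀, U, →_obs) be its δ-approximate observer, restricted to the states reachable from Q₀. Then Σ is δ-approximate initial-state opaque if and only if for every reachable observer state q = (x, z), the set int(q) = {x_I : (x_I, x_C) ∈ z} is not contained in X_S. -/
/-!
Statement 0: For a finite metric system Σ, δ-approximate initial-state opacity
holds iff every reachable state q = (x, z) of the δ-approximate observer
satisfies int(q) ⊄ X_S.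
-/

variable {X U Y : Type*}

/-- A finite path of length `n` of the system with initial states `X0` and
transition relation `tr`: `p 0 ∈ X0` and consecutive states are related by some input. -/
def IsPath (X0 : Set X) (tr : X → U → X → Prop) (n : ℕ) (p : ℕ → X) : Prop :=
  p 0 ∈ X0 ∧ ∀ i < n, ∃ u, tr (p i) u (p (i + 1))

/-- δ-approximate initial-state opacity. -/
def ApproxInitStateOpaque [MetricSpace Y] (X0 XS : Set X) (tr : X → U → X → Prop)
    (H : X → Y) (δ : ℝ) : Prop :=
  ∀ n : ℕ, ∀ p : ℕ → X, IsPath X0 tr n p → p 0 ∈ XS →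
    ∃ p' : ℕ → X, IsPath X0 tr n p' ∧ p' 0 ∉ XS ∧
      ∀ i ≤ n, dist (H (p i)) (H (p' i)) ≤ δ

/-- Initial states of the δ-approximate observer. -/
def ObsInit [MetricSpace Y] (X0 : Set X) (H : X → Y) (δ : ℝ) :
    Set (X × Set (X × X)) :=
  {q | q.1 ∈ X0 ∧ q.2 ⊆ X0 ×ˢ X0 ∧
    ∀ xI xC, xI ∈ X0 → xC ∈ X0 →
      ((xI, xC) ∈ q.2 ↔ xI = xC ∧ dist (H q.1) (H xC) ≤ δ)}

/-- Transition relation of the δ-approximate observer. -/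
def ObsTr [MetricSpace Y] (tr : X → U → X → Prop) (H : X → Y) (δ : ℝ)
    (q : X × Set (X × X)) (u : U) (q' : X × Set (X × X)) : Prop :=
  tr q.1 u q'.1 ∧
    q'.2 = {r : X × X | ∃ u' xC, (r.1, xC) ∈ q.2 ∧ tr xC u' r.2 ∧
      dist (H q'.1) (H r.2) ≤ δ}

/-- The set of observer states reachable from the initial observer states. -/
def ObsReach [MetricSpace Y] (X0 : Set X) (tr : X → U → X → Prop) (H : X → Y)
    (δ : ℝ) : Set (X × Set (X × X)) :=
  {q | ∃ q0 ∈ ObsInit X0 H δ,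
    Relation.ReflTransGen (fun a b => ∃ u, ObsTr tr H δ a u b) q0 q}

/-- The pairs of endpoints of the paths of length `n` whose outputs stay `δ`-close to those of `p`. -/
def matchedEndpoints [MetricSpace Y] (X0 : Set X) (tr : X → U → X → Prop) (H : X → Y) (δ : ℝ)
    (n : ℕ) (p : ℕ → X) : Set (X × X) :=
  {r | ∃ p' : ℕ → X, IsPath X0 tr n p' ∧ p' 0 = r.1 ∧ p' n = r.2 ∧
    ∀ i ≤ n, dist (H (p i)) (H (p' i)) ≤ δ}

theorem update_add_one_of_le {n i : ℕ} (p : ℕ → X) (x : X) (hi : i ≤ n) :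
    Function.update p (n + 1) x i = p i :=
  Function.update_of_ne (by lia) _ _

theorem IsPath.update {X0 : Set X} {tr : X → U → X → Prop} {n : ℕ} {p : ℕ → X}
    (hp : IsPath X0 tr n p) {u : U} {x : X} (hx : tr (p n) u x) :
    IsPath X0 tr (n + 1) (Function.update p (n + 1) x) := by
  refine ⟨by simpa using hp.1, fun i hi => ?_⟩
  rw [update_add_one_of_le p x (Nat.le_of_lt_succ hi)]
  rcases Nat.lt_succ_iff_lt_or_eq.mp hi with h | rfl
  · rw [update_add_one_of_le p x h]
    exact hp.2 i h
  · exact ⟨u, by simpa using hx⟩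

theorem IsPath.of_succ {X0 : Set X} {tr : X → U → X → Prop} {n : ℕ} {p : ℕ → X}
    (hp : IsPath X0 tr (n + 1) p) : IsPath X0 tr n p :=
  ⟨hp.1, fun i hi => hp.2 i (by lia)⟩

section Observer

variable [MetricSpace Y] {X0 : Set X} {tr : X → U → X → Prop} {H : X → Y} {δ : ℝ}

theorem matchedEndpoints_congr {n : ℕ} {p q : ℕ → X} (h : ∀ i ≤ n, p i = q i) :
    matchedEndpoints X0 tr H δ n p = matchedEndpoints X0 tr H δ n q := by
  ext r
  constructor <;> rintro ⟨p', hp', h0, hn, hd⟩ <;> refine ⟨p', hp', h0, hn, fun i hi => ?_⟩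
  · exact h i hi ▸ hd i hi
  · exact (h i hi).symm ▸ hd i hi

theorem mem_matchedEndpoints_zero {p : ℕ → X} {a c : X} :
    (a, c) ∈ matchedEndpoints X0 tr H δ 0 p ↔ a ∈ X0 ∧ a = c ∧ dist (H (p 0)) (H c) ≤ δ := by
  constructor
  · rintro ⟨p', hp', rfl, rfl, hd⟩
    exact ⟨hp'.1, rfl, hd 0 le_rfl⟩
  · rintro ⟨ha, rfl, hd⟩
    refine ⟨fun _ => a, ⟨ha, by simp⟩, rfl, rfl, fun i hi => ?_⟩
    rwa [Nat.le_zero.mp hi]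

theorem matchedEndpoints_succ (n : ℕ) (p : ℕ → X) :
    matchedEndpoints X0 tr H δ (n + 1) p =
      {r : X × X | ∃ u' xC, (r.1, xC) ∈ matchedEndpoints X0 tr H δ n p ∧ tr xC u' r.2 ∧
        dist (H (p (n + 1))) (H r.2) ≤ δ} := by
  ext ⟨a, c⟩
  constructor
  · rintro ⟨p', hp', h0, rfl, hd⟩
    obtain ⟨u, hu⟩ := hp'.2 n n.lt_succ_self
    exact ⟨u, p' n, ⟨p', hp'.of_succ, h0, rfl, fun i hi => hd i (by lia)⟩, hu, hd _ le_rfl⟩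
  · rintro ⟨u, _, ⟨p', hp', h0, rfl, hd⟩, hu, hc⟩
    refine ⟨Function.update p' (n + 1) c, hp'.update hu, by simpa using h0, by simp,
      fun i hi => ?_⟩
    rcases Nat.le_succ_iff.mp hi with h | rfl
    · rw [update_add_one_of_le p' c h]
      exact hd i h
    · simpa using hc

theorem mem_obsInit_iff {q : X × Set (X × X)} :
    q ∈ ObsInit X0 H δ ↔
      q.1 ∈ X0 ∧ q.2 = matchedEndpoints X0 tr H δ 0 (fun _ => q.1) := by
  constructor
  · rintro ⟨h1, hsub, h⟩
    refine ⟨h1, Set.ext fun ⟨a, c⟩ => ?_⟩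
    rw [mem_matchedEndpoints_zero]
    constructor
    · intro hac
      obtain ⟨ha, hc⟩ := hsub hac
      exact ⟨ha, (h a c ha hc).mp hac⟩
    · rintro ⟨ha, rfl, hd⟩
      exact (h a a ha ha).mpr ⟨rfl, hd⟩
  · rintro ⟨h1, h2⟩
    refine ⟨h1, ?_, fun a c ha hc => ?_⟩
    · rw [h2]
      rintro ⟨a, c⟩ hac
      obtain ⟨ha, rfl, -⟩ := mem_matchedEndpoints_zero.mp hac
      exact ⟨ha, ha⟩
    · rw [h2, mem_matchedEndpoints_zero]
      exact and_iff_right ha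

/-- The reachable observer states are exactly those obtained by running the observer along a path
of the system. -/
theorem mem_obsReach_iff {q : X × Set (X × X)} :
    q ∈ ObsReach X0 tr H δ ↔
      ∃ n p, IsPath X0 tr n p ∧ q = (p n, matchedEndpoints X0 tr H δ n p) := by
  constructor
  · rintro ⟨q0, hq0, hreach⟩
    induction hreach with
    | refl =>
      obtain ⟨h1, h2⟩ := (mem_obsInit_iff (tr := tr)).mp hq0
      exact ⟨0, fun _ => q0.1, ⟨h1, by simp⟩, Prod.ext rfl h2⟩
    | @tail _ q' _ hstep ih =>
      obtain ⟨n, p, hp, rfl⟩ := ih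
      obtain ⟨u, hu, hz⟩ := hstep
      refine ⟨n + 1, Function.update p (n + 1) q'.1, hp.update hu, Prod.ext (by simp) ?_⟩
      simp only
      rw [hz, matchedEndpoints_succ,
        matchedEndpoints_congr (fun i hi => update_add_one_of_le p q'.1 hi),
        Function.update_self]
  · rintro ⟨n, p, hp, rfl⟩
    induction n with
    | zero =>
      refine ⟨_, (mem_obsInit_iff (tr := tr)).mpr ⟨hp.1, ?_⟩, .refl⟩
      exact matchedEndpoints_congr fun i hi => by rw [Nat.le_zero.mp hi]
    | succ n ih =>
      obtain ⟨q0, hq0, hreach⟩ := ih hp.of_succ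
      obtain ⟨u, hu⟩ := hp.2 n n.lt_succ_self
      exact ⟨q0, hq0, hreach.tail ⟨u, hu, matchedEndpoints_succ n p⟩⟩

end Observer

/-- **Verification of approximate initial-state opacity via the observer.**
A finite metric system is δ-approximate initial-state opaque iff for every
reachable observer state `q = (x, z)`, `int(q) = {x_I | ∃ x_C, (x_I, x_C) ∈ z}`
is not contained in the secret set `XS`. -/
theorem approx_initial_state_opacity_iff_observer
    [Finite X] [Finite U] [MetricSpace Y]
    (X0 XS : Set X) (tr : X → U → X → Prop) (H : X → Y) (δ : ℝ) (hδ : 0 ≤ δ) :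
    ApproxInitStateOpaque X0 XS tr H δ ↔
      ∀ q ∈ ObsReach X0 tr H δ, ¬ ({xI | ∃ xC, (xI, xC) ∈ q.2} ⊆ XS) := by
  constructor
  · intro hop q hq hsub
    obtain ⟨n, p, hp, rfl⟩ := mem_obsReach_iff.mp hq
    have hsecret : p 0 ∈ XS :=
      hsub ⟨p n, p, hp, rfl, rfl, fun i _ => by simpa using hδ⟩
    obtain ⟨p', hp', h0, hd⟩ := hop n p hp hsecret
    exact h0 (hsub ⟨p' n, p', hp', rfl, rfl, hd⟩)
  · intro hobs n p hp _
    obtain ⟨_, ⟨_, p', hp', rfl, -, hd⟩, h0⟩ :=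
      Set.not_subset.mp (hobs _ (mem_obsReach_iff.mpr ⟨n, p, hp, rfl⟩))
    exact ⟨p', hp', h0, hd⟩
end

section
/- Let Σ = (X, X₀, X_S, U, f, H) be a discrete-time control system with X ⊆ ℝⁿ a finite union of boxes, X₀ = X, X_S ⊆ X such that X_S and X ∖ X_S are finite unions of boxes, U ⊆ ℝᵐ a finite union of boxes, f : X × U → X, and output map H : X → ℝᵖ; all norms are infinity norms and the output metric is d(y, y′) = ‖y − y′‖. Assume: (i) Σ is incrementally input-to-state stable (δ-ISS), i.e., there exist β of class KL and γ of class K∞ such that ‖x_{x,ν}(k) − x_{x′,ν′}(k)‖ ≤ β(‖x − x′‖, k) + γ(sup_{j∈ℕ} ‖ν(j) − ν′(j)‖) for all x, x′ ∈ X, all input runs ν, ν′ : ℕ → U, and all k ∈ ℕ; and (ii) ‖H(x) − H(x′)‖ ≤ α(‖x − x′‖) for all x, x′ ∈ X, where α is of class K∞. Let ε > 0 and let quantization parameters η, μ satisfy 0 < η ≤ min{span(X_S), span(X ∖ X_S)}, 0 < μ ≤ span(U), and β(α⁻¹(ε), 1) + γ(μ) + η ≤ α⁻¹(ε). Define the finite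 abstraction Σ̂ as the metric system with state set X̂ = [X]_η, initial states X̂₀ = [X]_η, secret states X̂_S = [X_S]_η, input set Û = [U]_μ, transitions x̂ →̂^û x̂′ iff ‖x̂′ − f(x̂, û)‖ ≤ η, and output map H restricted to X̂ (viewing Σ as the metric system with transitions x →^u f(x, u)). Then the relation R = {(x, x̂) ∈ X × X̂ : ‖x − x̂‖ ≤ α⁻¹(ε)} is an ε-InitSOP simulation relation from Σ to Σ̂, and its inverse {(x̂, x) : (x, x̂) ∈ R} is an ε-InitSOP simulation relation from Σ̂ to Σ; in particular Σ ⪯_I^ε Σ̂ and Σ̂ ⪯_I^ε Σ. -/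
/-!
Statement 6: for a δ-ISS discrete-time control system with a Lipschitz-type
output map, the quantized finite abstraction (with quantization parameters
satisfying the stated inequalities) is related to the concrete system by an
ε-InitSOP simulation relation in both directions, witnessed by
`R = {(x, x̂) : ‖x − x̂‖ ≤ α⁻¹(ε)}`.
-/

open Filter

/-- A class `K` function: continuous, strictly increasing on `[0, ∞)`, zero at zero. -/
def ClassK (γ : ℝ → ℝ) : Prop :=
  ContinuousOn γ (Set.Ici 0) ∧ StrictMonoOn γ (Set.Ici 0) ∧ γ 0 = 0

/-- A class `K∞` function: class `K` and unbounded. -/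
def ClassKInf (γ : ℝ → ℝ) : Prop :=
  ClassK γ ∧ Tendsto γ atTop atTop

/-- A class `KL` function. -/
def ClassKL (β : ℝ → ℝ → ℝ) : Prop :=
  (∀ t : ℝ, 0 ≤ t → ClassK fun r => β r t) ∧
  ∀ r : ℝ, 0 ≤ r →
    AntitoneOn (fun t => β r t) (Set.Ici 0) ∧
      Tendsto (fun t => β r t) atTop (nhds 0)

/-- The trajectory of the discrete-time control system `x⁺ = f(x, u)` from
`x0` under the input run `ν`. -/
def traj {A B : Type*} (f : A → B → A) (x0 : A) (ν : ℕ → B) : ℕ → A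
  | 0 => x0
  | k + 1 => f (traj f x0 ν k) (ν k)

/-- The η-quantization `[S]_η` of a set `S ⊆ ℝ^d`: the grid points of mesh η
belonging to `S`. -/
def grid {d : ℕ} (η : ℝ) (S : Set (Fin d → ℝ)) : Set (Fin d → ℝ) :=
  {a ∈ S | ∀ i, ∃ k : ℤ, a i = k * η}

/-- `S` is the finite union of the (nondegenerate) boxes `∏ᵢ [c j i, e j i]`,
`j = 0, …, M`. -/
def IsBoxUnion {d M : ℕ} (c e : Fin (M + 1) → Fin d → ℝ)
    (S : Set (Fin d → ℝ)) : Prop :=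
  (∀ j i, c j i < e j i) ∧ S = ⋃ j, {x | ∀ i, x i ∈ Set.Icc (c j i) (e j i)}

/-- The span of a finite union of boxes: the minimal side length. -/
noncomputable def spanOf {d M : ℕ} (c e : Fin (M + 1) → Fin (d + 1) → ℝ) : ℝ :=
  ⨅ j, ⨅ i, (e j i - c j i)

/-- `R` is an ε-approximate initial-state opacity preserving (ε-InitSOP)
simulation relation from the system `(X0, XS, tr, H)` to `(X0', XS', tr', H')`,
both with outputs in the same metric space `Y`. -/
def InitSOP {X X' U U' Y : Type*} [MetricSpace Y]
    (X0 XS : Set X) (tr : X → U → X → Prop) (H : X → Y)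
    (X0' XS' : Set X') (tr' : X' → U' → X' → Prop) (H' : X' → Y)
    (ε : ℝ) (R : Set (X × X')) : Prop :=
  (∀ x0 ∈ X0 ∩ XS, ∃ x0' ∈ X0' ∩ XS', (x0, x0') ∈ R) ∧
  (∀ x0' ∈ X0' \ XS', ∃ x0 ∈ X0 \ XS, (x0, x0') ∈ R) ∧
  (∀ p ∈ R, dist (H p.1) (H' p.2) ≤ ε) ∧
  (∀ p ∈ R,
    (∀ u x₁, tr p.1 u x₁ → ∃ u' x₂, tr' p.2 u' x₂ ∧ (x₁, x₂) ∈ R) ∧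
    (∀ u' x₂, tr' p.2 u' x₂ → ∃ u x₁, tr p.1 u x₁ ∧ (x₁, x₂) ∈ R))

theorem exists_int_mul_mem_Icc {a b η x : ℝ} (hη : 0 < η) (hab : η ≤ b - a)
    (hx : x ∈ Set.Icc a b) : ∃ k : ℤ, (k * η : ℝ) ∈ Set.Icc a b ∧ |x - k * η| ≤ η := by
  have h₁ : (⌊x / η⌋ : ℝ) * η ≤ x := (le_div_iff₀ hη).1 (Int.floor_le _)
  have h₂ : x < ((⌊x / η⌋ : ℝ) + 1) * η := (div_lt_iff₀ hη).1 (Int.lt_floor_add_one _)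
  obtain ⟨hx₁, hx₂⟩ := hx
  by_cases h : a ≤ (⌊x / η⌋ : ℝ) * η
  · refine ⟨⌊x / η⌋, ⟨h, by linarith⟩, ?_⟩
    rw [abs_le]
    constructor <;> linarith
  · refine ⟨⌊x / η⌋ + 1, ?_, ?_⟩ <;> push_cast
    · constructor <;> linarith
    · rw [abs_le]
      constructor <;> linarith

theorem spanOf_le {d M : ℕ} (c e : Fin (M + 1) → Fin (d + 1) → ℝ) (j : Fin (M + 1))
    (i : Fin (d + 1)) : spanOf c e ≤ e j i - c j i :=
  (ciInf_le (Set.finite_range _).bddBelow j).trans (ciInf_le (Set.finite_range _).bddBelow i)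

theorem IsBoxUnion.exists_mem_grid {d M : ℕ} {c e : Fin (M + 1) → Fin (d + 1) → ℝ}
    {S : Set (Fin (d + 1) → ℝ)} (hS : IsBoxUnion c e S) {η : ℝ} (hη : 0 < η)
    (hspan : η ≤ spanOf c e) {x : Fin (d + 1) → ℝ} (hx : x ∈ S) :
    ∃ y ∈ grid η S, ‖x - y‖ ≤ η := by
  obtain ⟨-, rfl⟩ := hS
  obtain ⟨j, hj⟩ := Set.mem_iUnion.1 hx
  choose k hk hkη using fun i =>
    exists_int_mul_mem_Icc hη (hspan.trans (spanOf_le c e j i)) (hj i)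
  exact ⟨fun i => k i * η, ⟨Set.mem_iUnion.2 ⟨j, hk⟩, fun i => ⟨k i, rfl⟩⟩,
    (pi_norm_le_iff_of_nonneg hη.le).2 hkη⟩

theorem ClassK.mono {γ : ℝ → ℝ} (hγ : ClassK γ) {r s : ℝ} (hr : 0 ≤ r) (hrs : r ≤ s) :
    γ r ≤ γ s :=
  hγ.2.1.monotoneOn hr (hr.trans hrs) hrs

theorem ClassK.nonneg {γ : ℝ → ℝ} (hγ : ClassK γ) {r : ℝ} (hr : 0 ≤ r) : 0 ≤ γ r :=
  hγ.2.2.symm.trans_le (hγ.mono le_rfl hr)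

/-- Exchanging the roles of the two systems keeps the output and transition conditions of an
ε-InitSOP simulation relation; only the initial conditions have to be checked again. -/
theorem InitSOP.symm {X X' U U' Y : Type*} [MetricSpace Y]
    {X0 XS : Set X} {tr : X → U → X → Prop} {H : X → Y}
    {X0' XS' : Set X'} {tr' : X' → U' → X' → Prop} {H' : X' → Y}
    {ε : ℝ} {R : Set (X × X')} (h : InitSOP X0 XS tr H X0' XS' tr' H' ε R)
    (h₁ : ∀ x' ∈ X0' ∩ XS', ∃ x ∈ X0 ∩ XS, (x, x') ∈ R)
    (h₂ : ∀ x ∈ X0 \ XS, ∃ x' ∈ X0' \ XS', (x, x') ∈ R) :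
    InitSOP X0' XS' tr' H' X0 XS tr H ε {q | (q.2, q.1) ∈ R} :=
  ⟨h₁, h₂, fun p hp => (dist_comm _ _).trans_le (h.2.2.1 (p.2, p.1) hp),
    fun p hp => (h.2.2.2 (p.2, p.1) hp).symm⟩

/-- **Opacity-preserving finite abstractions for δ-ISS systems.**
Under the stated assumptions on the δ-ISS control system and the quantization
parameters, the relation `R = {(x, x̂) : ‖x − x̂‖ ≤ α⁻¹(ε)}` (where
`c = α⁻¹(ε)`) is an ε-InitSOP simulation relation from Σ to its finite
abstraction Σ̂ and, conversely, its inverse is an ε-InitSOP simulation relation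
from Σ̂ to Σ; in particular `Σ ⪯_I^ε Σ̂` and `Σ̂ ⪯_I^ε Σ`. -/
theorem opacity_preserving_finite_abstraction
    {n m p MS MC MU MX : ℕ}
    (Xset XSset : Set (Fin (n + 1) → ℝ)) (Uset : Set (Fin (m + 1) → ℝ))
    (f : (Fin (n + 1) → ℝ) → (Fin (m + 1) → ℝ) → (Fin (n + 1) → ℝ))
    (Hout : (Fin (n + 1) → ℝ) → (Fin (p + 1) → ℝ))
    (hXS : XSset ⊆ Xset)
    (hf : ∀ x ∈ Xset, ∀ u ∈ Uset, f x u ∈ Xset)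
    -- the state set, secret set, its complement in `X`, and the input set are
    -- finite unions of boxes
    (cX eX : Fin (MX + 1) → Fin (n + 1) → ℝ) (hX : IsBoxUnion cX eX Xset)
    (cS eS : Fin (MS + 1) → Fin (n + 1) → ℝ) (hS : IsBoxUnion cS eS XSset)
    (cC eC : Fin (MC + 1) → Fin (n + 1) → ℝ) (hC : IsBoxUnion cC eC (Xset \ XSset))
    (cU eU : Fin (MU + 1) → Fin (m + 1) → ℝ) (hU : IsBoxUnion cU eU Uset)
    -- incremental input-to-state stability
    (β : ℝ → ℝ → ℝ) (γ α : ℝ → ℝ)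
    (hβ : ClassKL β) (hγ : ClassKInf γ) (hα : ClassKInf α)
    (hISS : ∀ x ∈ Xset, ∀ x' ∈ Xset, ∀ ν ν' : ℕ → Fin (m + 1) → ℝ,
      (∀ j, ν j ∈ Uset) → (∀ j, ν' j ∈ Uset) → ∀ k : ℕ,
        ‖traj f x ν k - traj f x' ν' k‖ ≤
          β ‖x - x'‖ (k : ℝ) + γ (⨆ j, ‖ν j - ν' j‖))
    -- Lipschitz-type estimate on the output map
    (hLip : ∀ x ∈ Xset, ∀ x' ∈ Xset, ‖Hout x - Hout x'‖ ≤ α ‖x - x'‖)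
    -- the desired precision and `c = α⁻¹(ε)`
    (ε : ℝ) (hε : 0 < ε) (c : ℝ) (hc0 : 0 ≤ c) (hcα : α c = ε)
    -- the quantization parameters
    (η μ : ℝ)
    (hη0 : 0 < η) (hηspan : η ≤ min (spanOf cS eS) (spanOf cC eC))
    (hμ0 : 0 < μ) (hμspan : μ ≤ spanOf cU eU)
    (hq : β c 1 + γ μ + η ≤ c) :
    InitSOP Xset XSset
        (fun x u x' => x ∈ Xset ∧ u ∈ Uset ∧ x' = f x u) Hout
        (grid η Xset) (grid η XSset)
        (fun xh uh xh' => xh ∈ grid η Xset ∧ uh ∈ grid μ Uset ∧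
          xh' ∈ grid η Xset ∧ ‖xh' - f xh uh‖ ≤ η) Hout
        ε {q | q.1 ∈ Xset ∧ q.2 ∈ grid η Xset ∧ ‖q.1 - q.2‖ ≤ c} ∧
    InitSOP (grid η Xset) (grid η XSset)
        (fun xh uh xh' => xh ∈ grid η Xset ∧ uh ∈ grid μ Uset ∧
          xh' ∈ grid η Xset ∧ ‖xh' - f xh uh‖ ≤ η) Hout
        Xset XSset
        (fun x u x' => x ∈ Xset ∧ u ∈ Uset ∧ x' = f x u) Hout
        ε {q | q.2 ∈ Xset ∧ q.1 ∈ grid η Xset ∧ ‖q.2 - q.1‖ ≤ c} ∧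
    (∃ R, InitSOP Xset XSset
        (fun x u x' => x ∈ Xset ∧ u ∈ Uset ∧ x' = f x u) Hout
        (grid η Xset) (grid η XSset)
        (fun xh uh xh' => xh ∈ grid η Xset ∧ uh ∈ grid μ Uset ∧
          xh' ∈ grid η Xset ∧ ‖xh' - f xh uh‖ ≤ η) Hout
        ε R) ∧
    (∃ R, InitSOP (grid η Xset) (grid η XSset)
        (fun xh uh xh' => xh ∈ grid η Xset ∧ uh ∈ grid μ Uset ∧
          xh' ∈ grid η Xset ∧ ‖xh' - f xh uh‖ ≤ η) Hout
        Xset XSset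
        (fun x u x' => x ∈ Xset ∧ u ∈ Uset ∧ x' = f x u) Hout
        ε R) := by
  have hβ₁ : ClassK fun r => β r 1 := hβ.1 1 zero_le_one
  have hηc : η ≤ c := by
    have h₁ : 0 ≤ β c 1 := hβ₁.nonneg hc0
    have h₂ := hγ.1.nonneg hμ0.le
    linarith
  have hgridS : grid η XSset ⊆ grid η Xset := fun x hx => ⟨hXS hx.1, hx.2⟩
  have hquantS : ∀ x ∈ XSset, ∃ y ∈ grid η XSset, ‖x - y‖ ≤ η := fun x hx =>
    hS.exists_mem_grid hη0 (hηspan.trans (min_le_left _ _)) hx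
  have hquantC : ∀ x ∈ Xset \ XSset, ∃ y ∈ grid η (Xset \ XSset), ‖x - y‖ ≤ η := fun x hx =>
    hC.exists_mem_grid hη0 (hηspan.trans (min_le_right _ _)) hx
  have hquant : ∀ x ∈ Xset, ∃ y ∈ grid η Xset, ‖x - y‖ ≤ η := by
    intro x hx
    by_cases hxS : x ∈ XSset
    · obtain ⟨y, hy, hxy⟩ := hquantS x hxS
      exact ⟨y, hgridS hy, hxy⟩
    · obtain ⟨y, hy, hxy⟩ := hquantC x ⟨hx, hxS⟩
      exact ⟨y, ⟨hy.1.1, hy.2⟩, hxy⟩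
  have hstep : ∀ x ∈ Xset, ∀ y ∈ Xset, ‖x - y‖ ≤ c → ∀ u ∈ Uset, ∀ v ∈ Uset, ‖u - v‖ ≤ μ →
      ∀ z, ‖z - f y v‖ ≤ η → ‖f x u - z‖ ≤ c := by
    intro x hx y hy hxy u hu v hv huv z hz
    have h := hISS x hx y hy (fun _ => u) (fun _ => v) (fun _ => hu) (fun _ => hv) 1
    simp only [traj, ciSup_const, Nat.cast_one] at h
    have h₁ : β ‖x - y‖ 1 ≤ β c 1 := hβ₁.mono (norm_nonneg _) hxy
    have h₂ : γ ‖u - v‖ ≤ γ μ := hγ.1.mono (norm_nonneg _) huv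
    have h₃ := norm_sub_le_norm_sub_add_norm_sub (f x u) (f y v) z
    rw [norm_sub_rev (f y v) z] at h₃
    linarith
  have hmain : InitSOP Xset XSset
      (fun x u x' => x ∈ Xset ∧ u ∈ Uset ∧ x' = f x u) Hout
      (grid η Xset) (grid η XSset)
      (fun xh uh xh' => xh ∈ grid η Xset ∧ uh ∈ grid μ Uset ∧
        xh' ∈ grid η Xset ∧ ‖xh' - f xh uh‖ ≤ η) Hout
      ε {q | q.1 ∈ Xset ∧ q.2 ∈ grid η Xset ∧ ‖q.1 - q.2‖ ≤ c} := by
    refine ⟨?_, ?_, ?_, ?_⟩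
    · rintro x ⟨hx, hxS⟩
      obtain ⟨y, hy, hxy⟩ := hquantS x hxS
      exact ⟨y, ⟨hgridS hy, hy⟩, hx, hgridS hy, hxy.trans hηc⟩
    · rintro y ⟨hy, hyS⟩
      exact ⟨y, ⟨hy.1, fun h => hyS ⟨h, hy.2⟩⟩, hy.1, hy, by simpa using hc0⟩
    · rintro ⟨x, y⟩ ⟨hx, hy, hxy⟩
      rw [dist_eq_norm, ← hcα]
      exact (hLip x hx y hy.1).trans (hα.1.mono (norm_nonneg _) hxy)
    · rintro ⟨x, y⟩ ⟨hx, hy, hxy⟩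
      refine ⟨?_, ?_⟩
      · rintro u _ ⟨-, hu, rfl⟩
        obtain ⟨v, hv, huv⟩ := hU.exists_mem_grid hμ0 hμspan hu
        obtain ⟨z, hz, hzη⟩ := hquant _ (hf y hy.1 v hv.1)
        rw [norm_sub_rev] at hzη
        exact ⟨v, z, ⟨hy, hv, hz, hzη⟩, hf x hx u hu, hz,
          hstep x hx y hy.1 hxy u hu v hv.1 huv z hzη⟩
      · rintro v z ⟨-, hv, hz, hzη⟩
        exact ⟨v, f x v, ⟨hx, hv.1, rfl⟩, hf x hx v hv.1, hz,
          hstep x hx y hy.1 hxy v hv.1 v hv.1 (by simpa using hμ0.le) z hzη⟩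
  have hinv := hmain.symm
    (fun y hy => ⟨y, ⟨hy.1.1, hy.2.1⟩, hy.1.1, hy.1, by simpa using hc0⟩)
    (fun x hx => by
      obtain ⟨y, hy, hxy⟩ := hquantC x hx
      exact ⟨y, ⟨⟨hy.1.1, hy.2⟩, fun h => hy.1.2 h.1⟩, hx.1, ⟨hy.1.1, hy.2⟩, hxy.trans hηc⟩)
  exact ⟨hmain, hinv, ⟨_, hmain⟩, ⟨_, hinv⟩⟩
end

section
/- Let Σ = (X, X₀, X_S, U, f, H) be a discrete-time control system with X ⊆ ℝⁿ, f : X × U → X, H : X → ℝᵖ, and let δ ≥ 0. Define R₀ = {(x, x̂) ∈ (X₀ ∩ X_S) × (X₀ ∖ X_S) : ‖H(x) − H(x̂)‖ ≤ δ} and R_u = {(x, x̂) ∈ X × X : ‖H(x) − H(x̂)‖ > δ}. Assume every x₀ ∈ X₀ ∩ X_S admits some x̂₀ ∈ X₀ ∖ X_S with (x₀, x̂₀) ∈ R₀, and suppose there exists a function B : X × X → ℝ such that: B(x, x̂) ≤ 0 for all (x, x̂) ∈ R₀; B(x, x̂) > 0 for all (x, x̂) ∈ R_u; and for every (x, x̂)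 ∈ X × X and every u ∈ U there exists û ∈ U with B(f(x, u), f(x̂, û)) ≤ B(x, x̂). Then for every (x₀, x̂₀) ∈ R₀ and every input run ν : ℕ → U there exists an input run ν̂ : ℕ → U such that (x_{x₀,ν}(t), x_{x̂₀,ν̂}(t)) ∉ R_u for all t ∈ ℕ; consequently, Σ is δ-approximate initial-state opaque. -/
/-- A relation between states that can be preserved along any transition of the first system by
choosing the input of the second one is preserved along whole trajectories. -/
theorem exists_traj_rel {A B : Type*} {f : A → B → A} {U : Set B} {R : A → A → Prop}
    (hR : ∀ x y, R x y → ∀ u ∈ U, ∃ v ∈ U, R (f x u) (f y v))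
    {x y : A} (hxy : R x y) {ν : ℕ → B} (hν : ∀ t, ν t ∈ U) :
    ∃ μ : ℕ → B, (∀ t, μ t ∈ U) ∧ ∀ t, R (traj f x ν t) (traj f y μ t) := by
  choose! g hgU hgR using hR
  let s : ℕ → A := fun t => Nat.rec y (fun k z => f z (g (traj f x ν k) z (ν k))) t
  have hs : ∀ t, R (traj f x ν t) (s t) := by
    intro t
    induction t with
    | zero => exact hxy
    | succ k ih => exact hgR _ _ ih _ (hν k)
  let μ : ℕ → B := fun k => g (traj f x ν k) (s k) (ν k)
  have htraj : ∀ t, traj f y μ t = s t := by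
    intro t
    induction t with
    | zero => rfl
    | succ k ih => simp only [traj, ih, s, μ]
  exact ⟨μ, fun t => hgU _ _ (hs t) _ (hν t), fun t => (htraj t).symm ▸ hs t⟩

/-- **Barrier certificates for verifying approximate initial-state opacity.** -/
theorem barrier_certificate_opacity {n m p : ℕ}
    (Xset X0 XS : Set (Fin (n + 1) → ℝ)) (Uset : Set (Fin (m + 1) → ℝ))
    (f : (Fin (n + 1) → ℝ) → (Fin (m + 1) → ℝ) → (Fin (n + 1) → ℝ))
    (Hout : (Fin (n + 1) → ℝ) → (Fin (p + 1) → ℝ))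
    (δ : ℝ) (hδ : 0 ≤ δ)
    (hX0 : X0 ⊆ Xset) (hXS : XS ⊆ Xset)
    (hf : ∀ x ∈ Xset, ∀ u ∈ Uset, f x u ∈ Xset)
    -- every secret initial state admits a δ-close non-secret initial state
    (hne : ∀ x0 ∈ X0 ∩ XS, ∃ xh0 ∈ X0 \ XS, ‖Hout x0 - Hout xh0‖ ≤ δ)
    (B : (Fin (n + 1) → ℝ) → (Fin (n + 1) → ℝ) → ℝ)
    -- B ≤ 0 on R₀
    (hB0 : ∀ x ∈ X0 ∩ XS, ∀ xh ∈ X0 \ XS, ‖Hout x - Hout xh‖ ≤ δ → B x xh ≤ 0)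
    -- B > 0 on R_u
    (hBu : ∀ x ∈ Xset, ∀ xh ∈ Xset, δ < ‖Hout x - Hout xh‖ → 0 < B x xh)
    -- non-increase of B along controlled transitions
    (hBd : ∀ x ∈ Xset, ∀ xh ∈ Xset, ∀ u ∈ Uset, ∃ uh ∈ Uset,
      B (f x u) (f xh uh) ≤ B x xh) :
    -- from any pair in R₀, every input run is matched by one avoiding R_u
    (∀ x0 ∈ X0 ∩ XS, ∀ xh0 ∈ X0 \ XS, ‖Hout x0 - Hout xh0‖ ≤ δ →
      ∀ ν : ℕ → Fin (m + 1) → ℝ, (∀ t, ν t ∈ Uset) →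
        ∃ νh : ℕ → Fin (m + 1) → ℝ, (∀ t, νh t ∈ Uset) ∧
          ∀ t : ℕ, ¬(traj f x0 ν t ∈ Xset ∧ traj f xh0 νh t ∈ Xset ∧
            δ < ‖Hout (traj f x0 ν t) - Hout (traj f xh0 νh t)‖)) ∧
    -- consequently, Σ is δ-approximate initial-state opaque
    (∀ x0 ∈ X0 ∩ XS, ∀ N : ℕ,
      ∀ ν : ℕ → Fin (m + 1) → ℝ, (∀ t, ν t ∈ Uset) →
        ∃ x0' ∈ X0 \ XS, ∃ ν' : ℕ → Fin (m + 1) → ℝ, (∀ t, ν' t ∈ Uset) ∧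
          ∀ k ≤ N, ‖Hout (traj f x0 ν k) - Hout (traj f x0' ν' k)‖ ≤ δ) := by
  have key : ∀ x0 ∈ X0 ∩ XS, ∀ xh0 ∈ X0 \ XS, ‖Hout x0 - Hout xh0‖ ≤ δ →
      ∀ ν : ℕ → Fin (m + 1) → ℝ, (∀ t, ν t ∈ Uset) →
        ∃ νh : ℕ → Fin (m + 1) → ℝ, (∀ t, νh t ∈ Uset) ∧
          ∀ t, ‖Hout (traj f x0 ν t) - Hout (traj f xh0 νh t)‖ ≤ δ := by
    intro x0 hx0 xh0 hxh0 hclose ν hν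
    obtain ⟨νh, hνh, hrel⟩ := exists_traj_rel (f := f) (U := Uset)
      (R := fun x xh => x ∈ Xset ∧ xh ∈ Xset ∧ B x xh ≤ 0)
      (fun x xh ⟨hx, hxh, hB⟩ u hu =>
        let ⟨uh, huh, hle⟩ := hBd x hx xh hxh u hu
        ⟨uh, huh, hf x hx u hu, hf xh hxh uh huh, hle.trans hB⟩)
      ⟨hX0 hx0.1, hX0 hxh0.1, hB0 x0 hx0 xh0 hxh0 hclose⟩ hν
    refine ⟨νh, hνh, fun t => not_lt.mp fun hlt => ?_⟩
    obtain ⟨hx, hxh, hB⟩ := hrel t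
    exact hB.not_gt (hBu _ hx _ hxh hlt)
  constructor
  · intro x0 hx0 xh0 hxh0 hclose ν hν
    obtain ⟨νh, hνh, h⟩ := key x0 hx0 xh0 hxh0 hclose ν hν
    exact ⟨νh, hνh, fun t ht => (h t).not_gt ht.2.2⟩
  · intro x0 hx0 N ν hν
    obtain ⟨xh0, hxh0, hclose⟩ := hne x0 hx0
    obtain ⟨νh, hνh, h⟩ := key x0 hx0 xh0 hxh0 hclose ν hν
    exact ⟨xh0, hxh0, νh, hνh, fun k _ => h k⟩
end
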